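/- arXiv:1706.06269 — 2 statements merged into one kernel-verified Lean document; each statement's English description precedes it below -/
import Mathlib

section
/- Let R_λ = R[x]/⟨x^{np^s} − λ⟩. Then: (a) R_λ is a finite commutative chain ring whose unique maximal ideal is generated by the image of x^n − λ₀; (b) in R_λ, the ideals generated by (x^n − λ₀)^{p^s} and by γ coincide, and the nilpotency index of the image of x^n − λ₀ (the least positive integer N with (x^n − λ₀)^N = 0 in R_λ) equals e·p^s; (c) the ideals of R_λ are exactly ⟨(x^n − λ₀)^ν⟩ for 0 ≤ ν ≤ e·p^s, and for each such ν the ideal ⟨(x^n − λ₀)^ν⟩ has exactly p^{mn(ep^s − ν)} elements. -/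
open Polynomial

section Chain

variable {A : Type*} [CommRing A] {t : A} {N : ℕ}

theorem chain_isUnit (hN : t ^ N = 0) (hM : (Ideal.span {t}).IsMaximal) (a : A)
    (ha : a ∉ Ideal.span {t}) : IsUnit a := by
  by_contra hu
  obtain ⟨M, hM', haM⟩ := exists_max_ideal_of_mem_nonunits (a := a) hu
  have htM : t ∈ M := hM'.isPrime.mem_of_pow_mem N (by rw [hN]; exact M.zero_mem)
  have hle : Ideal.span {t} ≤ M := by
    rw [Ideal.span_le]; simpa using htM
  have := hM.eq_of_le hM'.ne_top hle
  exact ha (this ▸ haM)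

theorem chain_elt (hN : t ^ N = 0) (hM : (Ideal.span {t}).IsMaximal) (a : A) (ha : a ≠ 0) :
    ∃ j < N, ∃ v : A, IsUnit v ∧ a = v * t ^ j := by
  have key : ∀ k, (∃ c, a = c * t ^ k) ∨ ∃ j < k, ∃ v : A, IsUnit v ∧ a = v * t ^ j := by
    intro k
    induction k with
    | zero => left; exact ⟨a, by simp⟩
    | succ k ih =>
      rcases ih with ⟨c, hc⟩ | ⟨j, hj, v, hv⟩
      · by_cases hct : c ∈ Ideal.span {t}
        · obtain ⟨d, hd⟩ := Ideal.mem_span_singleton'.1 hct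
          left; exact ⟨d, by rw [hc, ← hd]; ring⟩
        · right; exact ⟨k, by omega, c, chain_isUnit hN hM c hct, hc⟩
      · right; exact ⟨j, by omega, v, hv⟩
  rcases key N with ⟨c, hc⟩ | h
  · exact absurd (by rw [hc, hN, mul_zero]) ha
  · exact h

theorem chain_pow_eq_zero (hN' : ∀ k < N, t ^ k ≠ 0) {v : A} (hv : IsUnit v) {k : ℕ}
    (h : v * t ^ k = 0) : N ≤ k := by
  by_contra hk
  exact hN' k (by omega) ((hv.mul_right_eq_zero).1 h)

theorem chain_ideal (hN : t ^ N = 0) (hM : (Ideal.span {t}).IsMaximal) (I : Ideal A) :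
    ∃ ν ≤ N, I = Ideal.span {t ^ ν} := by
  classical
  have hex : ∃ k, t ^ k ∈ I := ⟨N, by rw [hN]; exact I.zero_mem⟩
  refine ⟨Nat.find hex, Nat.find_min' hex (by rw [hN]; exact I.zero_mem), ?_⟩
  apply le_antisymm
  · intro a ha
    by_cases h0 : a = 0
    · rw [h0]; exact Ideal.zero_mem _
    obtain ⟨j, hj, v, hv, rfl⟩ := chain_elt hN hM a h0
    have hjI : t ^ j ∈ I := (Ideal.unit_mul_mem_iff_mem I hv).1 ha
    have := Nat.find_min' hex hjI
    exact Ideal.mul_mem_left _ _ (Ideal.mem_span_singleton.2 (pow_dvd_pow t this))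
  · rw [Ideal.span_le]; simpa using Nat.find_spec hex

theorem chain_total (hN : t ^ N = 0) (hM : (Ideal.span {t}).IsMaximal) (I J : Ideal A) :
    I ≤ J ∨ J ≤ I := by
  obtain ⟨a, _, rfl⟩ := chain_ideal hN hM I
  obtain ⟨b, _, rfl⟩ := chain_ideal hN hM J
  rcases le_total a b with h | h
  · right; exact Ideal.span_singleton_le_span_singleton.2 (pow_dvd_pow t h)
  · left; exact Ideal.span_singleton_le_span_singleton.2 (pow_dvd_pow t h)

theorem chain_card_last (hN : t ^ N = 0) (hN' : ∀ k < N, t ^ k ≠ 0)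
    (hM : (Ideal.span {t}).IsMaximal) (hpos : 0 < N) :
    Nat.card (Ideal.span {t ^ (N - 1)}) = Nat.card (A ⧸ Ideal.span {t}) := by
  let f : A →ₗ[A] A := LinearMap.mulRight A (t ^ (N - 1))
  have hr : f.range = Ideal.span {t ^ (N - 1)} := by
    ext a; simp [f, Ideal.mem_span_singleton']
  have hk : f.ker = Ideal.span {t} := by
    ext a
    simp only [LinearMap.mem_ker, f, LinearMap.mulRight_apply]
    constructor
    · intro h
      by_contra ha
      have := chain_pow_eq_zero hN' (chain_isUnit hN hM a ha) h
      omega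
    · intro h
      obtain ⟨d, rfl⟩ := Ideal.mem_span_singleton'.1 h
      rw [mul_assoc, ← pow_succ', Nat.sub_add_cancel hpos, hN, mul_zero]
  rw [← hr]
  have := Nat.card_congr f.quotKerEquivRange.toEquiv
  rw [← this]
  exact Nat.card_congr (Submodule.quotEquivOfEq _ _ hk).toEquiv

theorem chain_card_step (hN : t ^ N = 0) (hN' : ∀ k < N, t ^ k ≠ 0)
    (hM : (Ideal.span {t}).IsMaximal) {ν : ℕ} (hν : ν < N) :
    Nat.card (Ideal.span {t ^ ν}) =
      Nat.card (A ⧸ Ideal.span {t}) * Nat.card (Ideal.span {t ^ (ν + 1)}) := by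
  let I : Ideal A := Ideal.span {t ^ ν}
  let f : I →ₗ[A] A := (LinearMap.mulRight A t).comp I.subtype
  have hr : f.range = Ideal.span {t ^ (ν + 1)} := by
    ext a
    constructor
    · rintro ⟨⟨b, hb⟩, rfl⟩
      obtain ⟨d, rfl⟩ := Ideal.mem_span_singleton'.1 hb
      exact Ideal.mem_span_singleton'.2 ⟨d, by simp [f]; ring⟩
    · intro h
      obtain ⟨d, rfl⟩ := Ideal.mem_span_singleton'.1 h
      exact ⟨⟨d * t ^ ν, Ideal.mem_span_singleton'.2 ⟨d, rfl⟩⟩, by simp [f]; ring⟩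
  have hk : f.ker.map I.subtype = Ideal.span {t ^ (N - 1)} := by
    ext a
    simp only [Submodule.mem_map, LinearMap.mem_ker, f]
    constructor
    · rintro ⟨⟨b, hb⟩, h, rfl⟩
      simp only [LinearMap.comp_apply, Submodule.subtype_apply, LinearMap.mulRight_apply] at h ⊢
      by_cases h0 : b = 0
      · rw [h0]; exact Ideal.zero_mem _
      obtain ⟨j, hj, v, hv, rfl⟩ := chain_elt hN hM b h0
      rw [mul_assoc, ← pow_succ] at h
      have := chain_pow_eq_zero hN' hv h
      have : j = N - 1 := by omega
      exact Ideal.mem_span_singleton'.2 ⟨v, by rw [this]⟩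
    · intro h
      have hle : Ideal.span {t ^ (N - 1)} ≤ I :=
        Ideal.span_singleton_le_span_singleton.2 (pow_dvd_pow t (by omega))
      refine ⟨⟨a, hle h⟩, ?_, rfl⟩
      obtain ⟨d, rfl⟩ := Ideal.mem_span_singleton'.1 h
      simp only [LinearMap.comp_apply, Submodule.subtype_apply, LinearMap.mulRight_apply]
      rw [mul_assoc, ← pow_succ, Nat.sub_add_cancel (by omega), hN, mul_zero]
  have h1 := Submodule.card_eq_card_quotient_mul_card f.ker
  rw [Nat.card_congr f.quotKerEquivRange.toEquiv, hr,
    Nat.card_congr (f.ker.equivMapOfInjective I.subtype I.injective_subtype).toEquiv, hk,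
    chain_card_last hN hN' hM (by omega)] at h1
  exact h1

theorem chain_card (hN : t ^ N = 0) (hN' : ∀ k < N, t ^ k ≠ 0)
    (hM : (Ideal.span {t}).IsMaximal) {ν : ℕ} (hν : ν ≤ N) :
    Nat.card (Ideal.span {t ^ ν}) = Nat.card (A ⧸ Ideal.span {t}) ^ (N - ν) := by
  induction hν using Nat.decreasingInduction with
  | self =>
    rw [hN, Ideal.span_singleton_zero]; simp
  | of_succ k hk ih =>
    rw [chain_card_step hN hN' hM hk, ih, ← pow_succ']
    congr 1; omega

end Chain

theorem frob_aux {A : Type*} [CommRing A] {p : ℕ} (hp : p.Prime) (s e : ℕ) (y a g c w : A)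
    (hpc : (p : A) = g * c) (hg : g ^ e = 0) (hw : IsUnit w)
    (hy : y ^ p ^ s = a ^ p ^ s + g * w) :
    ∃ u, IsUnit u ∧ (y - a) ^ p ^ s = g * u := by
  obtain ⟨r, hr⟩ := exists_add_pow_prime_pow_eq hp (y - a) a s
  rw [sub_add_cancel, hy, hpc] at hr
  have h1 : (y - a) ^ p ^ s = g * (w + (y - a) * (-(c * a * r))) := by linear_combination -hr
  refine ⟨_, ?_, h1⟩
  have hnil : IsNilpotent (y - a) := by
    refine ⟨p ^ s * e, ?_⟩
    rw [pow_mul, h1, mul_pow, hg, zero_mul]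
  have hnil' : IsNilpotent ((y - a) * (-(c * a * r))) := (Commute.all _ _).isNilpotent_mul_right hnil
  exact hnil'.isUnit_add_left_of_commute hw (Commute.all _ _)


/-- `R_λ = R[x]/⟨x^{np^s} − λ⟩`, for `λ = l₀^{p^s} + γw` over a finite
chain ring `R` of nilpotency index `e`, is a chain ring with maximal ideal
`⟨x^n − l₀⟩`; `⟨(x^n − l₀)^{p^s}⟩ = ⟨γ⟩`, the nilpotency index of `x^n − l₀` is `ep^s`,
the ideals are exactly the `⟨(x^n − l₀)^ν⟩` with `ν ≤ ep^s`, and `⟨(x^n − l₀)^ν⟩`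
has `p^{mn(ep^s − ν)}` elements. -/
theorem stmt16 {R : Type} [CommRing R] [Finite R]
    (e p m s n : ℕ) (he : 2 ≤ e) (hp : p.Prime) (hm : 0 < m) (hs : 0 < s) (hn : 0 < n)
    (hnp : Nat.gcd n p = 1)
    (γ : R) (hγ : γ ^ (e - 1) ≠ 0) (hγe : γ ^ e = 0)
    (hmax : ∀ a : R, a ∈ Ideal.span {γ} ↔ ¬ IsUnit a)
    (hres : Nat.card (R ⧸ Ideal.span {γ}) = p ^ m)
    (l₀ w : R) (hl₀ : IsUnit l₀) (hw : IsUnit w)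
    (hirr : Irreducible ((X ^ n - C l₀ : R[X]).map (Ideal.Quotient.mk (Ideal.span {γ})))) :
    (∀ I J : Ideal (R[X] ⧸ Ideal.span {(X ^ (n * p ^ s) - C (l₀ ^ p ^ s + γ * w) : R[X])}),
      I ≤ J ∨ J ≤ I) ∧
    (Ideal.span {Ideal.Quotient.mk
        (Ideal.span {(X ^ (n * p ^ s) - C (l₀ ^ p ^ s + γ * w) : R[X])})
        (X ^ n - C l₀)}).IsMaximal ∧
    (∀ I : Ideal (R[X] ⧸ Ideal.span {(X ^ (n * p ^ s) - C (l₀ ^ p ^ s + γ * w) : R[X])}),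
      I.IsMaximal →
      I = Ideal.span {Ideal.Quotient.mk
        (Ideal.span {(X ^ (n * p ^ s) - C (l₀ ^ p ^ s + γ * w) : R[X])})
        (X ^ n - C l₀)}) ∧
    Ideal.span {Ideal.Quotient.mk
        (Ideal.span {(X ^ (n * p ^ s) - C (l₀ ^ p ^ s + γ * w) : R[X])})
        ((X ^ n - C l₀) ^ p ^ s)} =
      Ideal.span {Ideal.Quotient.mk
        (Ideal.span {(X ^ (n * p ^ s) - C (l₀ ^ p ^ s + γ * w) : R[X])})
        (C γ)} ∧
    IsLeast {N : ℕ | 0 < N ∧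
      (Ideal.Quotient.mk (Ideal.span {(X ^ (n * p ^ s) - C (l₀ ^ p ^ s + γ * w) : R[X])})
        (X ^ n - C l₀)) ^ N = 0} (e * p ^ s) ∧
    (∀ I : Ideal (R[X] ⧸ Ideal.span {(X ^ (n * p ^ s) - C (l₀ ^ p ^ s + γ * w) : R[X])}),
      ∃ ν ≤ e * p ^ s,
        I = Ideal.span {Ideal.Quotient.mk
          (Ideal.span {(X ^ (n * p ^ s) - C (l₀ ^ p ^ s + γ * w) : R[X])})
          ((X ^ n - C l₀) ^ ν)}) ∧
    (∀ ν ≤ e * p ^ s,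
      Nat.card ↥(Ideal.span {Ideal.Quotient.mk
          (Ideal.span {(X ^ (n * p ^ s) - C (l₀ ^ p ^ s + γ * w) : R[X])})
          ((X ^ n - C l₀) ^ ν)}) = p ^ (m * n * (e * p ^ s - ν))) := by
  classical
  have hfm : (X ^ n - C l₀ : R[X]).Monic := monic_X_pow_sub_C l₀ hn.ne'
  have hq : 0 < p ^ s := pow_pos hp.pos s
  have hnt : Nontrivial R := ⟨⟨_, _, hγ⟩⟩
  have hγu : ¬ IsUnit γ := (hmax γ).1 (Ideal.mem_span_singleton_self γ)
  have hFm : (X ^ (n * p ^ s) - C (l₀ ^ p ^ s + γ * w) : R[X]).Monic :=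
    monic_X_pow_sub_C _ (Nat.mul_pos hn hq).ne'
  have hFd : (X ^ (n * p ^ s) - C (l₀ ^ p ^ s + γ * w) : R[X]).natDegree = n * p ^ s :=
    natDegree_X_pow_sub_C
  -- p is a multiple of γ
  have hK : (Ideal.span {γ}).IsMaximal := by
    rw [Ideal.isMaximal_iff]
    refine ⟨fun h => (hmax 1).1 h isUnit_one, fun J x hJ hx hxJ => ?_⟩
    have hu : IsUnit x := by
      by_contra h
      exact hx ((hmax x).2 h)
    rw [← Ideal.eq_top_iff_one]
    exact Ideal.eq_top_of_isUnit_mem J hxJ hu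
  have hpγ : (p : R) ∈ Ideal.span {γ} := by
    apply hK.isPrime.mem_of_pow_mem m
    rw [← Ideal.Quotient.eq_zero_iff_mem]
    have : ((Nat.card (R ⧸ Ideal.span {γ}) : ℕ) : R ⧸ Ideal.span {γ}) = 0 := by
      have := card_nsmul_eq_zero' (x := (1 : R ⧸ Ideal.span {γ}))
      simpa using this
    rw [hres] at this
    simpa using this
  obtain ⟨c, hc⟩ := Ideal.mem_span_singleton.1 hpγ
  letI : Field (R ⧸ Ideal.span {γ}) := Ideal.Quotient.field _
  haveI : Fact (Irreducible ((X ^ n - C l₀ : R[X]).map (Ideal.Quotient.mk (Ideal.span {γ})))) :=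
    ⟨hirr⟩
  generalize hF : (X ^ (n * p ^ s) - C (l₀ ^ p ^ s + γ * w) : R[X]) = F at *
  set t := Ideal.Quotient.mk (Ideal.span {F}) (X ^ n - C l₀) with ht
  -- t ^ q = γ u
  obtain ⟨u, hu, htu⟩ : ∃ u, IsUnit u ∧
      t ^ p ^ s = Ideal.Quotient.mk (Ideal.span {F}) (C γ) * u := by
    have h0 : Ideal.Quotient.mk (Ideal.span {F}) F = 0 :=
      Ideal.Quotient.eq_zero_iff_mem.2 (Ideal.mem_span_singleton_self F)
    have := frob_aux hp s e (Ideal.Quotient.mk (Ideal.span {F}) (X ^ n))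
      (Ideal.Quotient.mk (Ideal.span {F}) (C l₀)) (Ideal.Quotient.mk (Ideal.span {F}) (C γ))
      (Ideal.Quotient.mk (Ideal.span {F}) (C c)) (Ideal.Quotient.mk (Ideal.span {F}) (C w))
      (by rw [← map_mul, ← C_mul, ← hc]; simp) (by rw [← map_pow, ← C_pow, hγe]; simp)
      ((hw.map C).map _)
      (by
        rw [← sub_eq_zero, ← h0, ← hF]
        simp only [map_sub, map_add, map_mul, map_pow, pow_mul])
    rw [ht, map_sub]; exact this
  have hγt : Ideal.Quotient.mk (Ideal.span {F}) (C γ) ∈ Ideal.span {t} := by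
    have : Ideal.Quotient.mk (Ideal.span {F}) (C γ) * u ∈ Ideal.span {t} := by
      rw [← htu]
      exact Ideal.pow_mem_of_mem _ (Ideal.mem_span_singleton_self t) _ hq
    exact (Ideal.mul_unit_mem_iff_mem _ hu).1 this
  have hN : t ^ (e * p ^ s) = 0 := by
    rw [mul_comm, pow_mul, htu, mul_pow, ← map_pow, ← C_pow, hγe]; simp
  have hlast : t ^ (e * p ^ s - 1) ≠ 0 := by
    intro h
    have hsplit : e * p ^ s - 1 = p ^ s * (e - 1) + (p ^ s - 1) := by
      obtain ⟨e', rfl⟩ : ∃ e', e = e' + 1 := ⟨e - 1, by omega⟩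
      have : (e' + 1) * p ^ s = p ^ s * e' + p ^ s := by ring
      rw [this, Nat.add_sub_cancel]; omega
    rw [hsplit, pow_add, pow_mul, htu, mul_pow, mul_right_comm,
      (hu.pow (e - 1)).mul_left_eq_zero, ht, ← map_pow, ← map_pow, ← map_pow, ← map_mul,
      Ideal.Quotient.eq_zero_iff_mem, Ideal.mem_span_singleton] at h
    have hgm : ((X ^ n - C l₀ : R[X]) ^ (p ^ s - 1)).Monic := hfm.pow _
    refine hFm.not_dvd_of_natDegree_lt ?_ ?_ h
    · intro h0
      have := congrArg (fun f => f.coeff ((X ^ n - C l₀ : R[X]) ^ (p ^ s - 1)).natDegree) h0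
      simp only [coeff_C_mul, coeff_zero, hgm.coeff_natDegree, mul_one] at this
      exact hγ this
    · refine lt_of_le_of_lt (natDegree_C_mul_le _ _) ?_
      rw [hfm.natDegree_pow, natDegree_X_pow_sub_C, hFd, mul_comm]
      exact Nat.mul_lt_mul_of_pos_left (by omega) hn
  have hN' : ∀ k < e * p ^ s, t ^ k ≠ 0 := by
    intro k hk h
    exact hlast (pow_eq_zero_of_le (by omega) h)
  -- residue field
  set π := Ideal.Quotient.mk (Ideal.span {γ}) with hπ
  set fb := (X ^ n - C l₀ : R[X]).map π with hfb
  let φ₀ : R[X] →+* AdjoinRoot fb := (AdjoinRoot.mk fb).comp (mapRingHom π)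
  have hφ₀f : φ₀ (X ^ n - C l₀) = 0 := by
    simp only [φ₀, RingHom.comp_apply, coe_mapRingHom]
    exact AdjoinRoot.mk_self
  have hφ₀γ : φ₀ (C γ) = 0 := by
    have : π γ = 0 := Ideal.Quotient.eq_zero_iff_mem.2 (Ideal.mem_span_singleton_self γ)
    simp [φ₀, this]
  have hφ₀F : φ₀ F = 0 := by
    have h1 : φ₀ (X ^ n) = φ₀ (C l₀) := by rw [← sub_eq_zero, ← map_sub, hφ₀f]
    rw [← hF, map_sub, pow_mul, map_pow, h1, C_add, C_mul, C_pow, map_add, map_mul, hφ₀γ, map_pow]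
    ring
  let φ : (R[X] ⧸ Ideal.span {F}) →+* AdjoinRoot fb :=
    Ideal.Quotient.lift (Ideal.span {F}) φ₀ (by
      intro a ha
      obtain ⟨d, rfl⟩ := Ideal.mem_span_singleton'.1 ha
      rw [map_mul, hφ₀F, mul_zero])
  have hmapsurj : Function.Surjective (Polynomial.map π) :=
    map_surjective π Ideal.Quotient.mk_surjective
  have hφs : Function.Surjective φ := by
    apply Ideal.Quotient.lift_surjective_of_surjective
    exact AdjoinRoot.mk_surjective.comp hmapsurj
  have hφk : RingHom.ker φ = Ideal.span {t} := by
    apply le_antisymm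
    · intro a ha
      obtain ⟨g, rfl⟩ := Ideal.Quotient.mk_surjective a
      have hg : AdjoinRoot.mk fb (g.map π) = 0 := ha
      rw [AdjoinRoot.mk_eq_zero] at hg
      obtain ⟨h', hh'⟩ := hg
      obtain ⟨h, rfl⟩ := hmapsurj h'
      have h2 : C γ ∣ g - (X ^ n - C l₀) * h := by
        rw [C_dvd_iff_dvd_coeff]
        intro i
        rw [← Ideal.mem_span_singleton, ← Ideal.Quotient.eq_zero_iff_mem, ← hπ, ← coeff_map,
          Polynomial.map_sub, Polynomial.map_mul, hh', sub_self, coeff_zero]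
      obtain ⟨k, hk⟩ := h2
      have h3 : g = (X ^ n - C l₀) * h + C γ * k := by rw [← hk]; ring
      rw [h3, map_add, map_mul, map_mul]
      exact add_mem (Ideal.mul_mem_right _ _ (Ideal.mem_span_singleton_self t))
        (Ideal.mul_mem_right _ _ hγt)
    · rw [Ideal.span_le, Set.singleton_subset_iff]
      exact hφ₀f
  have hM : (Ideal.span {t}).IsMaximal := by
    rw [← hφk]
    exact RingHom.ker_isMaximal_of_surjective φ hφs
  have hcard : Nat.card ((R[X] ⧸ Ideal.span {F}) ⧸ Ideal.span {t}) = p ^ (m * n) := by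
    rw [← hφk, Nat.card_congr (RingHom.quotientKerEquivOfSurjective hφs).toEquiv]
    have hbm : fb.Monic := hfm.map π
    have hfin : Module.Finite (R ⧸ Ideal.span {γ}) (AdjoinRoot fb) := hbm.finite_adjoinRoot
    rw [Module.natCard_eq_pow_finrank (K := R ⧸ Ideal.span {γ}), hres,
      (AdjoinRoot.powerBasis' hbm).finrank, AdjoinRoot.powerBasis'_dim, hfb, hfm.natDegree_map,
      natDegree_X_pow_sub_C, pow_mul]
  refine ⟨chain_total hN hM, hM, ?_, ?_, ⟨⟨Nat.mul_pos (by omega) hq, hN⟩, ?_⟩, ?_, ?_⟩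
  · intro I hI
    have htI : t ∈ I := hI.isPrime.mem_of_pow_mem (e * p ^ s) (by rw [hN]; exact I.zero_mem)
    refine (hM.eq_of_le hI.ne_top ?_).symm
    rw [Ideal.span_le]; simpa using htI
  · rw [map_pow, ← ht, htu]
    exact Ideal.span_singleton_mul_right_unit hu _
  · rintro k ⟨_, hk⟩
    by_contra hlt
    exact hN' k (by omega) hk
  · intro I
    obtain ⟨ν, h1, h2⟩ := chain_ideal hN hM I
    exact ⟨ν, h1, by rw [map_pow]; exact h2⟩
  · intro ν hν
    rw [map_pow, ← ht, chain_card hN hN' hM hν, hcard, ← pow_mul]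
end

section
/- Let C = ⟨(x^n − λ₀)^ν⟩ be an ideal of R[x]/⟨x^{np^s} − λ⟩, where 0 ≤ ν ≤ e·p^s. Then the Hamming distance of C is: 1 if 0 ≤ ν ≤ (e−1)p^s; ℓ + 2 if (e−1)p^s + ℓp^{s−1} + 1 ≤ ν ≤ (e−1)p^s + (ℓ+1)p^{s−1} for some 0 ≤ ℓ ≤ p − 2; (i+1)p^k if ep^s − p^{s−k} + (i−1)p^{s−k−1} + 1 ≤ ν ≤ ep^s − p^{s−k} + i·p^{s−k−1} for some 1 ≤ i ≤ p − 1 and 1 ≤ k ≤ s − 1; and 0 if ν = e·p^s. -/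
open Polynomial

/-- The unique representative of degree `< deg q` of an element of `A[x]/⟨q⟩`
(for `q` monic). -/
noncomputable def polyRep {A : Type} [CommRing A] (q : A[X]) (c : A[X] ⧸ Ideal.span {q}) :
    A[X] :=
  Function.surjInv Ideal.Quotient.mk_surjective c %ₘ q

/-- Hamming weight of a codeword. -/
noncomputable def wH {A : Type} [CommRing A] (q : A[X]) (c : A[X] ⧸ Ideal.span {q}) : ℕ :=
  (polyRep q c).support.card

/-- Hamming distance of a code (an ideal of `A[x]/⟨q⟩`); `0` for the zero code. -/
noncomputable def dH {A : Type} [CommRing A] (q : A[X])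
    (I : Ideal (A[X] ⧸ Ideal.span {q})) : ℕ :=
  sInf {w : ℕ | ∃ c ∈ I, c ≠ 0 ∧ w = wH q c}

section FieldPart
variable {F : Type} [Field F]

/-- The `r`-th section of a polynomial: coefficients at positions `P * j + r`. -/
noncomputable def secP (P r : ℕ) (f : F[X]) : F[X] :=
  ∑ j ∈ Finset.range (f.natDegree + 1), monomial j (f.coeff (P * j + r))

theorem secP_coeff {P : ℕ} (hP : 0 < P) (r : ℕ) (f : F[X]) (j : ℕ) :
    (secP P r f).coeff j = f.coeff (P * j + r) := by
  unfold secP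
  rw [finsetSum_coeff]
  simp only [coeff_monomial]
  rw [Finset.sum_ite_eq' (Finset.range (f.natDegree + 1)) j]
  split_ifs with h
  · rfl
  · symm
    apply coeff_eq_zero_of_natDegree_lt
    simp at h
    nlinarith

theorem coeff_X_pow_expand {P : ℕ} (r r' j : ℕ) (hr : r < P) (hr' : r' < P) (g : F[X]) :
    (X ^ r * expand F P g).coeff (P * j + r') = if r = r' then g.coeff j else 0 := by
  have hP : 0 < P := by omega
  rw [coeff_X_pow_mul', coeff_expand hP]
  split_ifs with h1 h2 h3 h3 h3
  · subst h3
    rw [Nat.add_sub_cancel, Nat.mul_div_cancel_left _ hP]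
  · exfalso
    obtain ⟨q, hq⟩ := h2
    have h5 : P * j + r' = P * q + r := by omega
    have := congrArg (· % P) h5
    simp [Nat.mod_eq_of_lt hr, Nat.mod_eq_of_lt hr'] at this
    omega
  · exfalso
    subst h3
    apply h2
    rw [Nat.add_sub_cancel]
    exact Dvd.intro _ rfl
  · rfl
  · omega
  · rfl

theorem secP_decomp {P : ℕ} (hP : 0 < P) (f : F[X]) :
    f = ∑ r ∈ Finset.range P, X ^ r * expand F P (secP P r f) := by
  ext m
  obtain ⟨j, r', hr', rfl⟩ : ∃ j r', r' < P ∧ m = P * j + r' :=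
    ⟨m / P, m % P, Nat.mod_lt _ hP, (Nat.div_add_mod m P).symm⟩
  rw [finsetSum_coeff, Finset.sum_congr rfl (g := fun r => if r = r' then
    (secP P r f).coeff j else 0)]
  · rw [Finset.sum_ite_eq', if_pos (by simpa using hr'), secP_coeff hP]
  · intro r hr
    exact coeff_X_pow_expand r r' j (by simpa using hr) hr' _

theorem secP_sum {P : ℕ} (g : ℕ → F[X]) (r : ℕ) (hr : r < P) :
    secP P r (∑ r ∈ Finset.range P, X ^ r * expand F P (g r)) = g r := by
  have hP : 0 < P := by omega
  ext j
  rw [secP_coeff hP, finsetSum_coeff, Finset.sum_congr rfl (g := fun r' => if r' = r then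
    (g r').coeff j else 0)]
  · rw [Finset.sum_ite_eq', if_pos (by simpa using hr)]
  · intro r' hr'
    exact coeff_X_pow_expand r' r j (by simpa using hr') hr _

theorem secP_expand_mul {P : ℕ} (g f : F[X]) (r : ℕ) (hr : r < P) :
    secP P r (expand F P g * f) = g * secP P r f := by
  have hP : 0 < P := by omega
  conv_lhs => rw [secP_decomp hP f, Finset.mul_sum]
  rw [← secP_sum (fun r => g * secP P r f) r hr]
  congr 1
  apply Finset.sum_congr rfl
  intro i _
  rw [map_mul]; ring

theorem secP_card {P : ℕ} (hP : 0 < P) (f : F[X]) :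
    ∑ r ∈ Finset.range P, (secP P r f).support.card ≤ f.support.card := by
  rw [← Finset.card_sigma]
  apply Finset.card_le_card_of_injOn (fun x => P * x.2 + x.1)
  · rintro ⟨r, j⟩ h
    simp only [Finset.coe_sigma, Set.mem_sigma_iff, Finset.mem_coe, mem_support_iff,
      secP_coeff hP] at h
    simpa using h.2
  · rintro ⟨r, j⟩ h ⟨r', j'⟩ h' heq
    simp only [Finset.coe_sigma, Set.mem_sigma_iff, Finset.mem_coe, Finset.mem_range] at h h'
    simp only at heq
    have h1 := congrArg (· % P) heq
    simp [Nat.mod_eq_of_lt h.1, Nat.mod_eq_of_lt h'.1] at h1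
    subst h1
    have : j = j' := Nat.eq_of_mul_eq_mul_left hP (by omega)
    subst this
    rfl

theorem secP_natDegree {P : ℕ} (r : ℕ) (f : F[X]) (d : ℕ) (hP : 0 < P)
    (h : f.natDegree < P * d) : (secP P r f).natDegree < d := by
  have hd : 0 < d := by
    rcases Nat.eq_zero_or_pos d with rfl | h'
    · simp at h
    · exact h'
  rw [Nat.lt_iff_le_pred hd, natDegree_le_iff_coeff_eq_zero]
  intro N hN
  rw [secP_coeff hP]
  apply coeff_eq_zero_of_natDegree_lt
  have : P * d ≤ P * N := Nat.mul_le_mul_left _ (by omega)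
  omega

theorem card_ge_two {b : F} (hb : b ≠ 0) (f : F[X]) (hf : f ≠ 0) (h : (X - C b) ∣ f) :
    2 ≤ f.support.card := by
  by_contra hlt
  have : f.support.card ≤ 1 := by omega
  rw [card_support_le_one_iff_monomial] at this
  obtain ⟨k, c, rfl⟩ := this
  rw [dvd_iff_isRoot, IsRoot, eval_monomial] at h
  have hc : c ≠ 0 := by rintro rfl; simp at hf
  exact mul_ne_zero hc (pow_ne_zero _ hb) h

theorem small_deg {p : ℕ} [CharP F p] {b : F} (hb : b ≠ 0) (M : ℕ) :
    ∀ f : F[X], f ≠ 0 → f.natDegree < p → (X - C b) ^ M ∣ f → M + 1 ≤ f.support.card := by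
  induction M with
  | zero =>
    intro f hf _ _
    have : f.support.Nonempty := by simpa using hf
    simpa using this.card_pos
  | succ M ih =>
    intro f hf hd hdvd
    set k := f.natDegree with hk
    set g : F[X] := X * derivative f - C (k : F) * f with hg
    have hgc : ∀ j, g.coeff j = ((j : F) - k) * f.coeff j := by
      intro j
      rw [hg, coeff_sub, coeff_C_mul]
      cases j with
      | zero => simp
      | succ j => rw [coeff_X_mul, coeff_derivative]; push_cast; ring
    have h2 := card_ge_two hb f hf ((dvd_pow_self _ (Nat.succ_ne_zero M)).trans hdvd)
    have hsupp : g.support = f.support.erase k := by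
      ext j
      rw [Finset.mem_erase, mem_support_iff, mem_support_iff, hgc]
      constructor
      · intro h
        refine ⟨?_, right_ne_zero_of_mul h⟩
        rintro rfl
        simp at h
      · rintro ⟨h1, h3⟩
        refine mul_ne_zero ?_ h3
        intro h4
        have h5 : (j : F) = k := sub_eq_zero.1 h4
        have h6 := (CharP.natCast_eq_natCast F p).1 h5
        have hj : j ≤ k := le_natDegree_of_ne_zero h3
        exact h1 (Nat.ModEq.eq_of_lt_of_lt h6 (by omega) hd)
    have hkm : k ∈ f.support := by
      rw [mem_support_iff]; simpa [hk] using hf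
    have hcard : g.support.card = f.support.card - 1 := by
      rw [hsupp, Finset.card_erase_of_mem hkm]
    have hg0 : g ≠ 0 := by
      intro h; rw [h] at hcard; simp at hcard; omega
    have hgd : g.natDegree < p := by
      refine lt_of_le_of_lt ?_ hd
      rw [natDegree_le_iff_coeff_eq_zero]
      intro N hN
      rw [hgc, coeff_eq_zero_of_natDegree_lt hN, mul_zero]
    have hgdvd : (X - C b) ^ M ∣ g := by
      apply dvd_sub
      · exact Dvd.dvd.mul_left (by simpa using pow_sub_dvd_iterate_derivative_of_pow_dvd 1 hdvd) _
      · exact Dvd.dvd.mul_left ((pow_dvd_pow _ (Nat.le_succ M)).trans hdvd) _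
    have := ih g hg0 hgd hgdvd
    omega

theorem core {p : ℕ} (hp : p.Prime) [CharP F p] {a : F} (ha : a ≠ 0) (s t : ℕ) (f : F[X])
    (hf : f ≠ 0) (hd : f.natDegree < p ^ (s + 1)) (hdvd : (X - C a) ^ t ∣ f) :
    ∃ M, M ≤ p - 1 ∧ ∃ h : F[X], h ≠ 0 ∧ h.natDegree < p ^ s ∧ t ≤ p ^ s * (M + 1) ∧
      (X - C a) ^ (t - p ^ s * M) ∣ h ∧ (M + 1) * h.support.card ≤ f.support.card := by
  have : Fact p.Prime := ⟨hp⟩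
  set P := p ^ s with hPdef
  have hP : 0 < P := pow_pos hp.pos s
  set b := a ^ P with hbdef
  have hb : b ≠ 0 := pow_ne_zero _ ha
  have hdeg : ∀ r, (secP P r f).natDegree < p := fun r =>
    secP_natDegree r f p hP (by rw [hPdef, ← pow_succ]; exact hd)
  obtain ⟨r₀, hr₀, hne⟩ : ∃ r < P, secP P r f ≠ 0 := by
    by_contra hcon
    push Not at hcon
    apply hf
    rw [secP_decomp hP f]
    apply Finset.sum_eq_zero
    intro r hr
    rw [hcon r (by simpa using hr)]; simp
  have hex : ∃ M, ∃ r < P, ¬ (X - C b) ^ (M + 1) ∣ secP P r f := by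
    refine ⟨p, r₀, hr₀, fun h => ?_⟩
    have := natDegree_le_of_dvd h hne
    rw [natDegree_pow, natDegree_X_sub_C] at this
    have := hdeg r₀
    omega
  classical
  set M := Nat.find hex with hM
  obtain ⟨r₁, hr₁, hnd⟩ := Nat.find_spec hex
  rw [← hM] at hnd
  have hall : ∀ r < P, (X - C b) ^ M ∣ secP P r f := by
    intro r hr
    rcases Nat.eq_zero_or_pos M with h0 | h0
    · rw [h0]; simp
    · have := Nat.find_min hex (m := M - 1) (by omega)
      push Not at this
      have := this r hr
      rwa [Nat.sub_add_cancel h0] at this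
  have hMp : M ≤ p - 1 := by
    have := natDegree_le_of_dvd (hall r₀ hr₀) hne
    rw [natDegree_pow, natDegree_X_sub_C] at this
    have := hdeg r₀
    omega
  have hall' : ∀ r, ∃ g : F[X], r < P → secP P r f = (X - C b) ^ M * g := by
    intro r
    by_cases hr : r < P
    · obtain ⟨g, hg⟩ := hall r hr
      exact ⟨g, fun _ => hg⟩
    · exact ⟨0, fun h => absurd h hr⟩
  choose g hg using hall'
  set h : F[X] := ∑ r ∈ Finset.range P, C ((g r).eval b) * X ^ r with hh
  have hhc : ∀ r, h.coeff r = if r < P then (g r).eval b else 0 := by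
    intro r
    rw [hh, finsetSum_coeff]
    simp [coeff_X_pow]
  have hfrob : expand F P (X - C b) = (X - C a) ^ P := by
    rw [map_sub, expand_X, expand_C, hbdef, hPdef, sub_pow_char_pow, ← C_pow]
  set G : F[X] := ∑ r ∈ Finset.range P, X ^ r * expand F P (g r) with hG
  have hfG : f = (X - C a) ^ (P * M) * G := by
    rw [secP_decomp hP f, hG, Finset.mul_sum]
    apply Finset.sum_congr rfl
    intro r hr
    rw [hg r (by simpa using hr), map_mul, map_pow, hfrob, pow_mul]; ring
  have hGh : (X - C a) ^ P ∣ G - h := by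
    rw [hG, hh, ← Finset.sum_sub_distrib]
    apply Finset.dvd_sum
    intro r _
    have h1 : (X - C b) ∣ g r - C ((g r).eval b) := X_sub_C_dvd_sub_C_eval
    have h2 := map_dvd (expand F P) h1
    rw [hfrob, map_sub, expand_C] at h2
    have h3 := h2.mul_left (X ^ r)
    convert h3 using 1
    ring
  have hGdvd : (X - C a) ^ (t - P * M) ∣ G := by
    rcases le_total t (P * M) with h1 | h1
    · rw [Nat.sub_eq_zero_of_le h1]; simp
    · rw [hfG, ← Nat.add_sub_of_le h1, pow_add] at hdvd
      exact (mul_dvd_mul_iff_left (pow_ne_zero _ (X_sub_C_ne_zero a))).1 hdvd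
  have hh0 : h ≠ 0 := by
    intro h0
    have h1 := hhc r₁
    rw [h0, if_pos hr₁, coeff_zero] at h1
    have h2 : (X - C b) ∣ g r₁ := dvd_iff_isRoot.2 h1.symm
    apply hnd
    rw [hg r₁ hr₁, pow_succ]
    exact mul_dvd_mul_left _ h2
  have hhd : h.natDegree < P := by
    rw [natDegree_lt_iff_degree_lt hh0, degree_lt_iff_coeff_zero]
    intro m hm
    rw [hhc, if_neg (by omega)]
  have htP : t - P * M ≤ P := by
    by_contra hcon
    have h1 : (X - C a) ^ P ∣ G := (pow_dvd_pow _ (by omega)).trans hGdvd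
    have h2 : (X - C a) ^ P ∣ h := by
      have := dvd_sub h1 hGh
      simpa using this
    have := natDegree_le_of_dvd h2 hh0
    rw [natDegree_pow, natDegree_X_sub_C] at this
    omega
  refine ⟨M, hMp, h, hh0, hhd, by rw [mul_add]; omega, ?_, ?_⟩
  · have := dvd_sub hGdvd ((pow_dvd_pow _ htP).trans hGh)
    simpa using this
  · refine le_trans ?_ (secP_card hP f)
    have hsub : h.support ⊆ Finset.range P := by
      intro r hr
      rw [mem_support_iff, hhc] at hr
      rw [Finset.mem_range]
      by_contra hc
      simp [hc] at hr
    refine le_trans ?_ (Finset.sum_le_sum_of_subset hsub)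
    rw [mul_comm, ← smul_eq_mul]
    apply Finset.card_nsmul_le_sum
    intro r hr
    have hrP : r < P := by simpa using hsub hr
    apply small_deg (p := p) hb M _ _ (hdeg r) (hall r hrP)
    rw [hg r hrP]
    apply mul_ne_zero (pow_ne_zero _ (X_sub_C_ne_zero b))
    intro h0
    rw [mem_support_iff, hhc, if_pos hrP, h0] at hr
    simp at hr

theorem lower_one {p : ℕ} (hp : p.Prime) [CharP F p] {a : F} (ha : a ≠ 0) (k : ℕ) :
    ∀ (r i t : ℕ) (f : F[X]), 1 ≤ i → i ≤ p - 1 → f ≠ 0 → f.natDegree < p ^ (k + r + 1) →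
      p ^ (k + r + 1) + (i - 1) * p ^ r + 1 ≤ t + p ^ (r + 1) → (X - C a) ^ t ∣ f →
      (i + 1) * p ^ k ≤ f.support.card := by
  induction k with
  | zero =>
    intro r i t f hi hip hf hd ht hdvd
    rw [zero_add] at hd ht
    obtain ⟨M, hM, h, h0, hhd, htM, hhdvd, hcard⟩ := core hp ha r t f hf hd hdvd
    have hpos : 0 < h.support.card := by
      have : h.support.Nonempty := by simpa using h0
      exact this.card_pos
    have hpr : 0 < p ^ r := pow_pos hp.pos r
    rw [pow_zero, mul_one]
    refine le_trans ?_ hcard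
    have hMi : i ≤ M + 1 := by
      by_contra hc
      have : p ^ r * (M + 1) ≤ p ^ r * (i - 1) := Nat.mul_le_mul_left _ (by omega)
      nlinarith
    rcases Nat.lt_or_ge M i with h1 | h1
    · have hMe : M = i - 1 := by omega
      have h2 := card_ge_two ha h h0 ((dvd_pow_self _ (by
        rw [hMe, mul_comm (p ^ r)]; omega)).trans hhdvd)
      nlinarith
    · nlinarith
  | succ k ih =>
    intro r i t f hi hip hf hd ht hdvd
    have e1 : k + 1 + r + 1 = (k + r + 1) + 1 := by ring
    rw [e1] at hd ht
    obtain ⟨M, hM, h, h0, hhd, htM, hhdvd, hcard⟩ := core hp ha (k + r + 1) t f hf hd hdvd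
    have hp2 := hp.two_le
    set Q := p ^ (k + r + 1) with hQ
    have hQr : p ^ (r + 1) ≤ Q := Nat.pow_le_pow_right hp.pos (by omega)
    have hMe : M + 1 = p := by
      by_contra hc
      have h1 : Q * (M + 1) ≤ Q * (p - 1) := Nat.mul_le_mul_left _ (by omega)
      have h2 : Q * (p - 1) + Q = Q * p := by
        rw [← Nat.mul_succ]; congr 1; omega
      rw [pow_succ, ← hQ] at ht
      have : 0 ≤ (i - 1) * p ^ r := Nat.zero_le _
      omega
    have hQM : Q * p = Q * M + Q := by rw [← hMe]; ring
    have := ih r i (t - Q * M) h hi hip h0 hhd (by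
      rw [pow_succ p (k + r + 1), ← hQ] at ht
      omega) hhdvd
    rw [hMe] at hcard
    calc (i + 1) * p ^ (k + 1) = p * ((i + 1) * p ^ k) := by ring
      _ ≤ p * h.support.card := Nat.mul_le_mul_left _ this
      _ ≤ _ := hcard

theorem lower_n {p : ℕ} (hp : p.Prime) [CharP F p] {a : F} (ha : a ≠ 0) {n : ℕ} (hn : 0 < n)
    (k r i t : ℕ) (f : F[X]) (hi : 1 ≤ i) (hip : i ≤ p - 1) (hf : f ≠ 0)
    (hd : f.natDegree < n * p ^ (k + r + 1))
    (ht : p ^ (k + r + 1) + (i - 1) * p ^ r + 1 ≤ t + p ^ (r + 1))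
    (hdvd : (X ^ n - C a) ^ t ∣ f) : (i + 1) * p ^ k ≤ f.support.card := by
  obtain ⟨r₀, hr₀, hne⟩ : ∃ r < n, secP n r f ≠ 0 := by
    by_contra hcon
    push Not at hcon
    apply hf
    rw [secP_decomp hn f]
    apply Finset.sum_eq_zero
    intro r hr
    rw [hcon r (by simpa using hr)]; simp
  refine le_trans ?_ (secP_card hn f)
  refine le_trans ?_ (Finset.single_le_sum (f := fun r => (secP n r f).support.card)
    (fun _ _ => Nat.zero_le _) (Finset.mem_range.2 hr₀))
  apply lower_one hp ha k r i t _ hi hip hne (secP_natDegree r₀ f _ hn hd) ht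
  obtain ⟨u, rfl⟩ := hdvd
  have : (X ^ n - C a) ^ t = expand F n ((X - C a) ^ t) := by simp
  rw [this, secP_expand_mul _ _ _ hr₀]
  exact dvd_mul_right _ _

theorem upper_aux {d : ℕ} (hd : 0 < d) (b : F) (i : ℕ) :
    ((X ^ d - C b) ^ i).support.card ≤ i + 1 := by
  have : (X ^ d - C b) ^ i = expand F d ((X - C b) ^ i) := by simp
  rw [this]
  have h2 : (expand F d ((X - C b) ^ i)).support ⊆
      (Finset.range (i + 1)).image (fun j => j * d) := by
    intro m hm
    rw [mem_support_iff, coeff_expand hd] at hm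
    split_ifs at hm with h
    · obtain ⟨j, rfl⟩ := h
      rw [Nat.mul_div_cancel_left _ hd] at hm
      have := le_natDegree_of_ne_zero hm
      rw [natDegree_pow, natDegree_X_sub_C] at this
      rw [Finset.mem_image]
      exact ⟨j, by rw [Finset.mem_range]; omega, mul_comm _ _⟩
    · exact absurd rfl hm
  exact (Finset.card_le_card h2).trans (Finset.card_image_le.trans (by simp))

theorem upper_n {p : ℕ} (hp : p.Prime) [CharP F p] (a : F) {n : ℕ} (hn : 0 < n) (k r i : ℕ) :
    ((X ^ n - C a) ^ (p ^ (r + 1) * (p ^ k - 1) + p ^ r * i)).support.card ≤ (i + 1) * p ^ k := by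
  have : Fact p.Prime := ⟨hp⟩
  have hpow : ∀ r, (X ^ n - C a) ^ p ^ r = X ^ (n * p ^ r) - C (a ^ p ^ r) := by
    intro r
    rw [sub_pow_char_pow, ← pow_mul, C_pow]
  rw [pow_add, pow_mul, pow_mul, hpow, hpow]
  refine (card_support_mul_le).trans ?_
  rw [mul_comm]
  refine Nat.mul_le_mul (upper_aux (Nat.mul_pos hn (pow_pos hp.pos _)) _ _) ?_
  refine (upper_aux (Nat.mul_pos hn (pow_pos hp.pos _)) _ _).trans ?_
  have : 0 < p ^ k := pow_pos hp.pos k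
  omega

end FieldPart
section RingPart
variable {R : Type} [CommRing R]

theorem polyRep_mk {q : R[X]} (hq : q.Monic) (g : R[X]) :
    polyRep q (Ideal.Quotient.mk (Ideal.span {q}) g) = g %ₘ q := by
  unfold polyRep
  apply modByMonic_eq_of_dvd_sub hq
  rw [← Ideal.mem_span_singleton, ← Ideal.Quotient.eq]
  exact Function.surjInv_eq _ _

theorem wH_pos {q : R[X]} (hq : q.Monic) (c : R[X] ⧸ Ideal.span {q}) (hc : c ≠ 0) :
    0 < wH q c := by
  obtain ⟨g, rfl⟩ := Ideal.Quotient.mk_surjective c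
  unfold wH
  rw [polyRep_mk hq, Finset.card_pos]
  rw [Finset.nonempty_iff_ne_empty, Ne, support_eq_empty, modByMonic_eq_zero_iff_dvd hq]
  rwa [Ne, Ideal.Quotient.eq_zero_iff_mem, Ideal.mem_span_singleton] at hc

theorem dH_eq {q : R[X]} (I : Ideal (R[X] ⧸ Ideal.span {q})) (d : ℕ)
    (hup : ∃ c ∈ I, c ≠ 0 ∧ wH q c ≤ d) (hlow : ∀ c ∈ I, c ≠ 0 → d ≤ wH q c) : dH q I = d := by
  obtain ⟨c, hcI, hc0, hcd⟩ := hup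
  unfold dH
  apply le_antisymm
  · refine le_trans (Nat.sInf_le ?_) hcd
    exact ⟨c, hcI, hc0, rfl⟩
  · obtain ⟨c', h1, h2, h3⟩ := Nat.sInf_mem
      (s := {w : ℕ | ∃ c ∈ I, c ≠ 0 ∧ w = wH q c}) ⟨wH q c, c, hcI, hc0, rfl⟩
    rw [h3]
    exact hlow c' h1 h2

variable {F : Type} [Field F] (φ : R →+* F)

theorem supp_eq {e : ℕ} {γ : R} (he : 2 ≤ e) (hγ : γ ^ (e - 1) ≠ 0) (hγe : γ ^ e = 0)
    (hφ : ∀ a, φ a = 0 ↔ γ ∣ a) (hmax : ∀ a : R, γ ∣ a ↔ ¬ IsUnit a) (g : R[X]) :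
    (C (γ ^ (e - 1)) * g).support = (g.map φ).support := by
  ext j
  rw [mem_support_iff, mem_support_iff, coeff_C_mul, coeff_map, not_iff_not, hφ]
  constructor
  · intro h
    rw [hmax]
    intro hu
    exact hγ ((hu.mul_left_eq_zero).1 h)
  · rintro ⟨b, hb⟩
    rw [hb, ← mul_assoc, ← pow_succ, Nat.sub_add_cancel (by omega), hγe, zero_mul]

theorem key {e p s n : ℕ} {γ l₀ w : R} (hp : p.Prime) (hs : 0 < s) (hγe : γ ^ e = 0)
    (hpγ : γ ∣ (p : R)) (hw : IsUnit w) (q : R[X])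
    (hqdef : q = X ^ (n * p ^ s) - C (l₀ ^ p ^ s + γ * w)) :
    let mk := Ideal.Quotient.mk (Ideal.span {q})
    ∃ U, IsUnit U ∧ mk (X ^ n - C l₀) ^ p ^ s = mk (C γ) * U := by
  intro mk
  obtain ⟨u, hu⟩ := hpγ
  obtain ⟨r, hr⟩ := exists_add_pow_prime_pow_eq hp (X ^ n - C l₀ : R[X]) (C l₀) s
  have h0 : mk q = 0 := by
    rw [Ideal.Quotient.eq_zero_iff_mem]
    exact Ideal.mem_span_singleton_self _
  have h1 : (X ^ n - C l₀ : R[X]) ^ p ^ s = q +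
      C γ * (C w - C u * (X ^ n - C l₀) * C l₀ * r) := by
    rw [sub_add_cancel, ← pow_mul] at hr
    have hp' : (p : R[X]) = C γ * C u := by rw [← C_mul, ← hu]; simp
    rw [hqdef, hr, hp', C_add, C_pow, C_mul]
    ring
  have h2 : mk (X ^ n - C l₀) ^ p ^ s =
      mk (C γ) * (mk (C w) + mk (X ^ n - C l₀) * mk (-(C u * C l₀ * r))) := by
    rw [← map_pow, h1, map_add, h0, zero_add]
    simp only [map_mul, map_sub, map_neg]
    ring
  refine ⟨_, ?_, h2⟩
  have hnil : IsNilpotent (mk (X ^ n - C l₀)) := by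
    refine ⟨p ^ s * e, ?_⟩
    rw [pow_mul, h2, mul_pow, ← map_pow, ← C_pow, hγe]
    simp
  apply IsNilpotent.isUnit_add_left_of_commute _ _ (Commute.all _ _)
  · exact Commute.isNilpotent_mul_right (Commute.all _ _) hnil
  · exact (hw.map C).map mk

theorem partA {e p s n : ℕ} {γ l₀ w : R} (he : 2 ≤ e) (hp : p.Prime) (hs : 0 < s) (hn : 0 < n)
    (hγ : γ ^ (e - 1) ≠ 0) (hγe : γ ^ e = 0)
    (hφ : ∀ a, φ a = 0 ↔ γ ∣ a) (hmax : ∀ a : R, γ ∣ a ↔ ¬ IsUnit a) (hpγ : γ ∣ (p : R))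
    (hw : IsUnit w) (q : R[X])
    (hqdef : q = X ^ (n * p ^ s) - C (l₀ ^ p ^ s + γ * w)) (ν t : ℕ) (ht : t < p ^ s) (hν : ν ≤ (e - 1) * p ^ s + t) :
    ∃ c ∈ (Ideal.span {Ideal.Quotient.mk (Ideal.span {q})
          ((X ^ n - C l₀) ^ ν)}), c ≠ 0 ∧
      wH q c =
        ((X ^ n - C (φ l₀)) ^ t).support.card := by
  have hN : 0 < n * p ^ s := Nat.mul_pos hn (pow_pos hp.pos s)
  have hR : Nontrivial R := ⟨⟨_, _, hγ⟩⟩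
  have hq : q.Monic := hqdef ▸
    monic_X_pow_sub_C _ hN.ne'
  obtain ⟨U, hU, hk⟩ := key (n := n) (l₀ := l₀) hp hs hγe hpγ hw q hqdef
  set mk := Ideal.Quotient.mk (Ideal.span {q}) with hmk
  have hsupp := supp_eq φ he hγ hγe hφ hmax ((X ^ n - C l₀) ^ t)
  have hmap : ((X ^ n - C l₀) ^ t : R[X]).map φ = (X ^ n - C (φ l₀)) ^ t := by simp
  rw [hmap] at hsupp
  have hmonF : ((X ^ n - C (φ l₀)) ^ t).Monic := (monic_X_pow_sub_C _ hn.ne').pow t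
  set G : R[X] := C (γ ^ (e - 1)) * (X ^ n - C l₀) ^ t with hG
  have hG0 : G ≠ 0 := by
    intro h
    rw [h, support_zero] at hsupp
    exact hmonF.ne_zero (support_eq_empty.1 hsupp.symm)
  have hGq : G %ₘ q = G := by
    rw [modByMonic_eq_self_iff hq, hqdef, degree_X_pow_sub_C hN]
    refine lt_of_le_of_lt degree_le_natDegree ?_
    rw [Nat.cast_lt]
    refine lt_of_le_of_lt ((natDegree_C_mul_le _ _).trans natDegree_pow_le) ?_
    rw [natDegree_X_pow_sub_C, mul_comm]
    exact Nat.mul_lt_mul_of_pos_left ht hn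
  have hrep : polyRep q (mk G) = G := by rw [polyRep_mk hq, hGq]
  refine ⟨mk G, ?_, ?_, ?_⟩
  · rw [Ideal.mem_span_singleton, map_pow]
    have h1 : mk (X ^ n - C l₀) ^ ((e - 1) * p ^ s + t) = mk G * U ^ (e - 1) := by
      rw [pow_add, mul_comm (e - 1), pow_mul, hk, mul_pow, hG, map_mul, map_pow, map_pow, map_pow]
      ring
    have h2 : mk (X ^ n - C l₀) ^ ν ∣ mk G * U ^ (e - 1) := h1 ▸ pow_dvd_pow _ hν
    exact ((hU.pow (e - 1)).dvd_mul_right).1 h2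
  · intro h
    have h3 : polyRep q (mk G) = 0 := by
      rw [h, ← map_zero mk, polyRep_mk hq, zero_modByMonic]
    exact hG0 (hrep ▸ h3)
  · unfold wH
    rw [hrep, hsupp]

theorem partB {e p s n : ℕ} {γ l₀ w : R} (he : 2 ≤ e) (hp : p.Prime) (hs : 0 < s) (hn : 0 < n)
    [CharP F p]
    (hγ : γ ^ (e - 1) ≠ 0) (hγe : γ ^ e = 0)
    (hφ : ∀ a, φ a = 0 ↔ γ ∣ a) (hmax : ∀ a : R, γ ∣ a ↔ ¬ IsUnit a) (hpγ : γ ∣ (p : R))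
    (hw : IsUnit w) (q : R[X])
    (hqdef : q = X ^ (n * p ^ s) - C (l₀ ^ p ^ s + γ * w)) (ν t : ℕ) (ht : t ≤ p ^ s) (hν : ν = (e - 1) * p ^ s + t)
    (c : R[X] ⧸ Ideal.span {q})
    (hc : c ∈ (Ideal.span {Ideal.Quotient.mk (Ideal.span {q})
          ((X ^ n - C l₀) ^ ν)})) (hc0 : c ≠ 0) :
    ∃ f : F[X], f ≠ 0 ∧ f.natDegree < n * p ^ s ∧ (X ^ n - C (φ l₀)) ^ t ∣ f ∧
      wH q c = f.support.card := by
  have : Fact p.Prime := ⟨hp⟩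
  have hN : 0 < n * p ^ s := Nat.mul_pos hn (pow_pos hp.pos s)
  have hR : Nontrivial R := ⟨⟨_, _, hγ⟩⟩
  have hq : q.Monic := hqdef ▸
    monic_X_pow_sub_C _ hN.ne'
  obtain ⟨U, hU, hk⟩ := key (n := n) (l₀ := l₀) hp hs hγe hpγ hw q hqdef
  have hqmap : q.map φ =
      (X ^ n - C (φ l₀)) ^ p ^ s := by
    have : φ γ = 0 := (hφ γ).2 dvd_rfl
    rw [hqdef, sub_pow_char_pow, ← pow_mul]
    simp [this]
  have hqd : q.natDegree = n * p ^ s := by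
    rw [hqdef]; exact natDegree_X_pow_sub_C
  have hpos := wH_pos hq c hc0
  set mk := Ideal.Quotient.mk (Ideal.span {q}) with hmk
  rw [Ideal.mem_span_singleton] at hc
  obtain ⟨d, hd⟩ := hc
  obtain ⟨h, hh⟩ := Ideal.Quotient.mk_surjective (U ^ (e - 1) * d)
  have hcm : c = mk (C (γ ^ (e - 1)) * ((X ^ n - C l₀) ^ t * h)) := by
    rw [hd, hν, map_pow, pow_add, mul_comm (e - 1), pow_mul, hk, mul_pow, map_mul, map_mul,
      map_pow, map_pow, map_pow, hmk, hh]
    ring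
  have hrep : polyRep q c = C (γ ^ (e - 1)) * (((X ^ n - C l₀) ^ t * h) %ₘ q) := by
    rw [hcm, polyRep_mk hq, ← smul_eq_C_mul, ← smul_eq_C_mul, smul_modByMonic]
  have hwt : wH q c = ((((X ^ n - C l₀) ^ t * h) %ₘ q).map φ).support.card := by
    unfold wH
    rw [hrep, supp_eq φ he hγ hγe hφ hmax]
  refine ⟨_, ?_, ?_, ?_, hwt⟩
  · intro h0
    rw [h0, support_zero, Finset.card_empty] at hwt
    omega
  · refine lt_of_le_of_lt natDegree_map_le ?_
    rw [← hqd]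
    apply natDegree_modByMonic_lt _ hq
    intro h1
    rw [h1, natDegree_one] at hqd
    omega
  · have h1 := modByMonic_add_div ((X ^ n - C l₀) ^ t * h) q
    have h2 := congrArg (Polynomial.map φ) h1
    rw [Polynomial.map_add, Polynomial.map_mul, hqmap, Polynomial.map_mul] at h2
    have hmap : ((X ^ n - C l₀) ^ t : R[X]).map φ = (X ^ n - C (φ l₀)) ^ t := by simp
    rw [hmap] at h2
    rw [eq_sub_of_add_eq h2]
    exact dvd_sub (dvd_mul_right _ _) ((pow_dvd_pow _ ht).mul_right _)

theorem partAll {e p s n : ℕ} {γ l₀ w : R} (he : 2 ≤ e) (hp : p.Prime) (hs : 0 < s) (hn : 0 < n)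
    [CharP F p]
    (hγ : γ ^ (e - 1) ≠ 0) (hγe : γ ^ e = 0)
    (hφ : ∀ a, φ a = 0 ↔ γ ∣ a) (hmax : ∀ a : R, γ ∣ a ↔ ¬ IsUnit a)
    (hl₀ : IsUnit l₀) (hw : IsUnit w) (ν : ℕ) (hν : ν ≤ e * p ^ s) (q : R[X])
    (hq : q = X ^ (n * p ^ s) - C (l₀ ^ p ^ s + γ * w))
    (I : Ideal (R[X] ⧸ Ideal.span {q}))
    (hI : I = Ideal.span {Ideal.Quotient.mk (Ideal.span {q}) ((X ^ n - C l₀) ^ ν)}) :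
    (ν ≤ (e - 1) * p ^ s → dH q I = 1) ∧
    (∀ i k r, s = k + r + 1 → 1 ≤ i → i ≤ p - 1 →
      (e - 1) * p ^ s + (p ^ s - p ^ (r + 1)) + (i - 1) * p ^ r + 1 ≤ ν →
      ν ≤ (e - 1) * p ^ s + (p ^ s - p ^ (r + 1)) + i * p ^ r → dH q I = (i + 1) * p ^ k) ∧
    (ν = e * p ^ s → dH q I = 0) := by
  have hpγ : γ ∣ (p : R) := by rw [← hφ, map_natCast, CharP.cast_eq_zero]
  have hN : 0 < n * p ^ s := Nat.mul_pos hn (pow_pos hp.pos s)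
  have hqm : q.Monic := hq ▸ monic_X_pow_sub_C _ hN.ne'
  have ha : φ l₀ ≠ 0 := (hl₀.map φ).ne_zero
  have hes : e * p ^ s = (e - 1) * p ^ s + p ^ s := by
    rw [← Nat.succ_mul]; congr 1; omega
  refine ⟨?_, ?_, ?_⟩
  · intro h
    apply dH_eq
    · subst hI
      obtain ⟨c, h1, h2, h3⟩ := partA φ (l₀ := l₀) he hp hs hn hγ hγe hφ hmax hpγ hw q hq ν 0
        (pow_pos hp.pos s) (by simpa using h)
      refine ⟨c, h1, h2, ?_⟩
      rw [h3, pow_zero]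
      exact card_support_le_one_iff_monomial.2 ⟨0, 1, rfl⟩
    · intro c _ hc
      exact wH_pos hqm c hc
  · intro i k r hskr hi hip hlo hhi
    have hp2 := hp.two_le
    have hpr : 0 < p ^ r := pow_pos hp.pos r
    have hle : p ^ (r + 1) ≤ p ^ s := Nat.pow_le_pow_right hp.pos (by omega)
    have hir : i * p ^ r < p ^ (r + 1) := by
      rw [pow_succ, mul_comm]
      exact Nat.mul_lt_mul_of_pos_left (by omega) hpr
    have ht1 : p ^ (r + 1) * (p ^ k - 1) + p ^ r * i = p ^ s - p ^ (r + 1) + i * p ^ r := by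
      rw [Nat.mul_sub, ← pow_add, mul_one, mul_comm (p ^ r), hskr]
      congr 3
      ring
    apply dH_eq
    · subst hI
      obtain ⟨c, h1, h2, h3⟩ := partA φ (l₀ := l₀) he hp hs hn hγ hγe hφ hmax hpγ hw q hq ν
        (p ^ (r + 1) * (p ^ k - 1) + p ^ r * i)
        (by omega) (by omega)
      exact ⟨c, h1, h2, h3 ▸ upper_n hp _ hn k r i⟩
    · intro c hc hc0
      subst hI
      obtain ⟨f, h1, h2, h3, h4⟩ := partB φ he hp hs hn hγ hγe hφ hmax hpγ hw q hq ν
        (ν - (e - 1) * p ^ s) (by omega) (by omega) c hc hc0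
      rw [h4]
      rw [hskr] at h2
      refine lower_n hp ha hn k r i _ f hi hip h1 h2 ?_ h3
      rw [← hskr]
      omega
  · intro h
    have : I = ⊥ := by
      obtain ⟨U, hU, hk⟩ := key (n := n) (l₀ := l₀) hp hs hγe hpγ hw q hq
      subst hI
      rw [Ideal.span_singleton_eq_bot, map_pow, h, mul_comm, pow_mul, hk, mul_pow, ← map_pow,
        ← C_pow, hγe]
      simp
    unfold dH
    have hempty : {w : ℕ | ∃ c ∈ I, c ≠ 0 ∧ w = wH q c} = ∅ := by
      rw [Set.eq_empty_iff_forall_notMem]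
      rintro x ⟨c, h1, h2, _⟩
      rw [this, Ideal.mem_bot] at h1
      exact h2 h1
    rw [hempty, Nat.sInf_empty]

end RingPart

/-- Hamming distances of the `λ`-constacyclic codes `⟨(x^n − λ₀)^ν⟩` of
length `np^s` over a finite chain ring of nilpotency index `e`, `λ = λ₀^{p^s} + γw`. -/
theorem stmt17 {R : Type} [CommRing R] [Finite R]
    (e p m s n : ℕ) (he : 2 ≤ e) (hp : p.Prime) (hm : 0 < m) (hs : 0 < s) (hn : 0 < n)
    (hnp : Nat.gcd n p = 1)
    (γ : R) (hγ : γ ^ (e - 1) ≠ 0) (hγe : γ ^ e = 0)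
    (hmax : ∀ a : R, a ∈ Ideal.span {γ} ↔ ¬ IsUnit a)
    (hres : Nat.card (R ⧸ Ideal.span {γ}) = p ^ m)
    (l₀ w : R) (hl₀ : IsUnit l₀) (hw : IsUnit w)
    (hirr : Irreducible ((X ^ n - C l₀ : R[X]).map (Ideal.Quotient.mk (Ideal.span {γ}))))
    (ν : ℕ) (hν : ν ≤ e * p ^ s) :
    (ν ≤ (e - 1) * p ^ s →
      dH (X ^ (n * p ^ s) - C (l₀ ^ p ^ s + γ * w))
        (Ideal.span {Ideal.Quotient.mk
          (Ideal.span {(X ^ (n * p ^ s) - C (l₀ ^ p ^ s + γ * w) : R[X])})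
          ((X ^ n - C l₀) ^ ν)}) = 1) ∧
    (∀ ℓ, ℓ ≤ p - 2 → (e - 1) * p ^ s + ℓ * p ^ (s - 1) + 1 ≤ ν →
      ν ≤ (e - 1) * p ^ s + (ℓ + 1) * p ^ (s - 1) →
      dH (X ^ (n * p ^ s) - C (l₀ ^ p ^ s + γ * w))
        (Ideal.span {Ideal.Quotient.mk
          (Ideal.span {(X ^ (n * p ^ s) - C (l₀ ^ p ^ s + γ * w) : R[X])})
          ((X ^ n - C l₀) ^ ν)}) = ℓ + 2) ∧
    (∀ i k, 1 ≤ i → i ≤ p - 1 → 1 ≤ k → k ≤ s - 1 →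
      e * p ^ s - p ^ (s - k) + (i - 1) * p ^ (s - k - 1) + 1 ≤ ν →
      ν ≤ e * p ^ s - p ^ (s - k) + i * p ^ (s - k - 1) →
      dH (X ^ (n * p ^ s) - C (l₀ ^ p ^ s + γ * w))
        (Ideal.span {Ideal.Quotient.mk
          (Ideal.span {(X ^ (n * p ^ s) - C (l₀ ^ p ^ s + γ * w) : R[X])})
          ((X ^ n - C l₀) ^ ν)}) = (i + 1) * p ^ k) ∧
    (ν = e * p ^ s →
      dH (X ^ (n * p ^ s) - C (l₀ ^ p ^ s + γ * w))
        (Ideal.span {Ideal.Quotient.mk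
          (Ideal.span {(X ^ (n * p ^ s) - C (l₀ ^ p ^ s + γ * w) : R[X])})
          ((X ^ n - C l₀) ^ ν)}) = 0) := by
  have hmax' : ∀ a : R, γ ∣ a ↔ ¬ IsUnit a := fun a => by
    rw [← hmax, Ideal.mem_span_singleton]
  have hne : Ideal.span {γ} ≠ (⊤ : Ideal R) := by
    rw [Ne, Ideal.eq_top_iff_one, hmax]
    simp
  have hmx : (Ideal.span {γ}).IsMaximal := by
    refine Ideal.isMaximal_iff.2 ⟨fun h => hne ((Ideal.eq_top_iff_one _).2 h), ?_⟩
    intro J x _ hx hxJ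
    rw [hmax, not_not] at hx
    rw [← Ideal.eq_top_iff_one]
    exact Ideal.eq_top_of_isUnit_mem J hxJ hx
  letI : Field (R ⧸ Ideal.span {γ}) := Ideal.Quotient.field _
  have hchar : CharP (R ⧸ Ideal.span {γ}) p := by
    rw [CharP.charP_iff_prime_eq_zero hp]
    have : Finite (R ⧸ Ideal.span {γ}) :=
      Finite.of_surjective _ (Ideal.Quotient.mk_surjective (I := Ideal.span {γ}))
    have := Fintype.ofFinite (R ⧸ Ideal.span {γ})
    have h1 := Nat.cast_card_eq_zero (R ⧸ Ideal.span {γ})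
    rw [← Nat.card_eq_fintype_card, hres, Nat.cast_pow] at h1
    exact pow_eq_zero_iff hm.ne' |>.1 h1
  have hφ : ∀ a, Ideal.Quotient.mk (Ideal.span {γ}) a = 0 ↔ γ ∣ a := fun a => by
    rw [Ideal.Quotient.eq_zero_iff_mem, Ideal.mem_span_singleton]
  obtain ⟨h1, h2, h3⟩ := partAll (Ideal.Quotient.mk (Ideal.span {γ})) he hp hs hn hγ hγe hφ hmax'
    hl₀ hw ν hν _ rfl _ rfl
  have hp2 := hp.two_le
  refine ⟨h1, ?_, ?_, h3⟩
  · intro ℓ hℓ hlo hhi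
    have := h2 (ℓ + 1) 0 (s - 1) (by omega) (by omega) (by omega)
      (by rw [Nat.sub_add_cancel hs]; simpa using hlo)
      (by rw [Nat.sub_add_cancel hs]; simpa using hhi)
    simpa using this
  · intro i k hi hip hk hks hlo hhi
    have e1 : s - k - 1 + 1 = s - k := by omega
    have hle : p ^ (s - k) ≤ p ^ s := Nat.pow_le_pow_right hp.pos (by omega)
    have hes : e * p ^ s = (e - 1) * p ^ s + p ^ s := by
      rw [← Nat.succ_mul]; congr 1; omega
    exact h2 i k (s - k - 1) (by omega) hi hip (by rw [e1]; omega) (by rw [e1]; omega)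
end
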